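/- arXiv:2105.04712 — 2 statements merged into one kernel-verified Lean document; each statement's English description precedes it below -/
import Mathlib

section
/- There exists a universal constant c ≥ 1 such that for all α, β ∈ (0,1] and K, L > 0 there exists M = M(K, L, α, β) > 0 with the following property. Let X and Y be finite-dimensional real normed spaces, let f : S_X → S_Y be a bijection between the unit spheres satisfying (1/L)·‖x − y‖_X^{1/β} ≤ ‖f(x) − f(y)‖_Y ≤ K·‖x − y‖_X^α for all x, y ∈ S_X, let f̃ be the degree-α radial extension of f, and let P ⊆ X be a finite nonempty set of n points. Then there exists t ∈ X with ‖t‖_X ≤ ((M/n) Σ_{x∈P} ‖x‖_X^α)^{1/α} such that the map g(x) = f̃(x − t) satisfies ‖g(x) − g(y)‖_Y ≤ (1 + 2^α·K)·‖x − y‖_X^α for all x, y ∈ X and Σ_{x∈P} Σ_{y∈P} ‖g(x) − g(y)‖_Y ≥ (1/c) · Σ_{x∈P} Σ_{y∈P} ‖x − y‖_X^α; that is, g embeds the α-snowflake of X into Y with average distortion O(1 + K) with respect to P. -/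
open scoped Classical
open Finset

universe u v

/-- The degree-`p` radial extension of a map `g` between unit spheres:
`g̃(x) = ‖x‖^p · g(x/‖x‖)` for `x ≠ 0`, and `g̃(0) = 0`. -/
noncomputable def radialExt {U V : Type*} [NormedAddCommGroup U] [NormedSpace ℝ U]
    [NormedAddCommGroup V] [NormedSpace ℝ V] (p : ℝ) (g : U → V) (x : U) : V :=
  if x = 0 then 0 else ‖x‖ ^ p • g (‖x‖⁻¹ • x)


namespace Aux
open MeasureTheory Metric Set

/-- Radial retraction onto the closed ball of radius `R`. -/
noncomputable def rho {E : Type*} [NormedAddCommGroup E] [NormedSpace ℝ E] (R : ℝ) (x : E) : E :=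
  (R / max R ‖x‖) • x

section
variable {E : Type*} [NormedAddCommGroup E] [NormedSpace ℝ E]

lemma rho_of_le {R : ℝ} (hR : 0 < R) {x : E} (hx : ‖x‖ ≤ R) : rho R x = x := by
  simp [rho, max_eq_left hx, hR.ne']

lemma norm_rho_of_ge {R : ℝ} (hR : 0 < R) {x : E} (hx : R ≤ ‖x‖) : ‖rho R x‖ = R := by
  have : 0 < ‖x‖ := hR.trans_le hx
  rw [rho, max_eq_right hx, norm_smul, Real.norm_of_nonneg (by positivity)]
  field_simp

lemma norm_rho_le {R : ℝ} (hR : 0 < R) (x : E) : ‖rho R x‖ ≤ R := by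
  rcases le_total ‖x‖ R with h | h
  · rw [rho_of_le hR h]; exact h
  · exact (norm_rho_of_ge hR h).le

lemma continuous_rho {R : ℝ} (hR : 0 < R) : Continuous (rho R : E → E) := by
  unfold rho
  refine Continuous.smul (Continuous.div continuous_const (by fun_prop) ?_) continuous_id
  intro x; exact (lt_max_of_lt_left hR).ne'

lemma rho_lip {R : ℝ} (hR : 0 < R) (x y : E) : ‖rho R x - rho R y‖ ≤ 2 * ‖x - y‖ := by
  set p := max R ‖x‖ with hp
  set q := max R ‖y‖ with hq
  have hp0 : 0 < p := lt_max_of_lt_left hR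
  have hq0 : 0 < q := lt_max_of_lt_left hR
  have hpR : R ≤ p := le_max_left _ _
  have hqy : ‖y‖ ≤ q := le_max_right _ _
  have hpq : |q - p| ≤ ‖x - y‖ := by
    have := abs_max_sub_max_le_abs ‖y‖ ‖x‖ R
    rw [hp, hq, max_comm R, max_comm R]
    refine this.trans ?_
    rw [norm_sub_rev]
    exact abs_norm_sub_norm_le y x
  have e : rho R x - rho R y = (R / p) • (x - y) + (R / p - R / q) • y := by
    simp only [rho, ← hp, ← hq]; module
  rw [e]
  have h1 : ‖(R / p) • (x - y)‖ ≤ ‖x - y‖ := by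
    rw [norm_smul, Real.norm_of_nonneg (by positivity)]
    exact mul_le_of_le_one_left (norm_nonneg _) ((div_le_one hp0).2 hpR)
  have h2 : ‖(R / p - R / q) • y‖ ≤ ‖x - y‖ := by
    have : R / p - R / q = (R / p) * ((q - p) / q) := by field_simp
    rw [norm_smul, this, norm_mul, Real.norm_of_nonneg (by positivity : 0 ≤ R / p), norm_div,
      Real.norm_of_nonneg hq0.le, Real.norm_eq_abs]
    have a1 : R / p ≤ 1 := (div_le_one hp0).2 hpR
    have a2 : ‖y‖ / q ≤ 1 := (div_le_one hq0).2 hqy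
    calc R / p * (|q - p| / q) * ‖y‖ = (R / p) * |q - p| * (‖y‖ / q) := by ring
      _ ≤ 1 * |q - p| * 1 := by gcongr
      _ ≤ _ := by simpa using hpq
  calc _ ≤ _ := norm_add_le _ _
    _ ≤ _ := by linarith
end

section
variable {E : Type*} [NormedAddCommGroup E] [InnerProductSpace ℝ E] [FiniteDimensional ℝ E]

lemma det_poly (A : E →L[ℝ] E) : ∃ p : Polynomial ℝ, p.natDegree ≤ Module.finrank ℝ E ∧
    ∀ t : ℝ, p.eval t = (ContinuousLinearMap.id ℝ E + t • A).det := by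
  let b := Module.finBasis ℝ E
  let M := LinearMap.toMatrix b b (A : E →ₗ[ℝ] E)
  refine ⟨Matrix.det ((Polynomial.X : Polynomial ℝ) • M.map Polynomial.C
    + (1 : Matrix _ _ ℝ).map Polynomial.C), ?_, ?_⟩
  · simpa using Polynomial.natDegree_det_X_add_C_le M 1
  · intro t
    rw [ContinuousLinearMap.det, ← LinearMap.det_toMatrix b, ← Polynomial.coe_evalRingHom,
      RingHom.map_det]
    congr 1
    ext i j
    simp [M, Matrix.one_apply, Matrix.map_apply]
    split_ifs <;> simp <;> ring

lemma det_interp (A : E →L[ℝ] E) (s : Finset ℝ) (hs : Module.finrank ℝ E < s.card) :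
    (ContinuousLinearMap.id ℝ E + A).det =
      ∑ t ∈ s, (ContinuousLinearMap.id ℝ E + t • A).det * (Lagrange.basis s id t).eval 1 := by
  obtain ⟨p, hp, hpe⟩ := det_poly A
  have h := Lagrange.eq_interpolate (s := s) (v := id) (f := p) Function.injective_id.injOn
    ((Polynomial.degree_le_natDegree).trans_lt (by exact_mod_cast hp.trans_lt hs))
  have h1 := congrArg (Polynomial.eval 1) h
  rw [hpe, Lagrange.interpolate_apply, Polynomial.eval_finsetSum] at h1
  simpa [hpe] using h1

lemma exists_det_pos : ∃ δ > 0, ∀ A : E →L[ℝ] E, ‖A‖ < δ →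
    0 < (ContinuousLinearMap.id ℝ E + A).det := by
  have hc : Continuous fun A : E →L[ℝ] E => (ContinuousLinearMap.id ℝ E + A).det :=
    ContinuousLinearMap.continuous_det.comp (by fun_prop)
  have h0 : (0 : ℝ) < (ContinuousLinearMap.id ℝ E + (0 : E →L[ℝ] E)).det := by
    simp [ContinuousLinearMap.det]
  have := hc.continuousAt.eventually_mem (isOpen_Ioi.mem_nhds h0)
  obtain ⟨δ, hδ, h⟩ := Metric.eventually_nhds_iff.1 this
  exact ⟨δ, hδ, fun A hA => h (by simpa using hA)⟩

variable [MeasurableSpace E] [BorelSpace E]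

lemma no_retract {R : ℝ} (hR : 0 < R) (r : E → E) (hr : ContDiff ℝ 1 r)
    (hn : ∀ x, ‖r x‖ = R) (hid : ∀ x, ‖x‖ = R → r x = x) : False := by
  set B : Set E := closedBall 0 R with hB
  have hBc : IsCompact B := isCompact_closedBall 0 R
  have hmem : ∀ x, x ∈ B ↔ ‖x‖ ≤ R := fun x => by simp [B]
  let v : E → E := fun x => r x - x
  have hv : ContDiff ℝ 1 v := hr.sub contDiff_id
  have hvd : ∀ x, DifferentiableAt ℝ v x := fun x => hv.differentiable (by norm_num) x
  have hv'c : Continuous (fderiv ℝ v) := hv.continuous_fderiv (by norm_num)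
  obtain ⟨C, hC⟩ := hBc.exists_bound_of_continuousOn hv'c.continuousOn
  have hC0 : 0 ≤ C := (norm_nonneg _).trans (hC 0 (by simp [B, hR.le]))
  have hvl : ∀ x ∈ B, ∀ y ∈ B, ‖v x - v y‖ ≤ C * ‖x - y‖ := fun x hx y hy =>
    (convex_closedBall 0 R).norm_image_sub_le_of_norm_fderiv_le (fun z _ => hvd z) hC hy hx
  let u : E → E := fun x => v (rho R x)
  have hrB : ∀ x : E, rho R x ∈ B := fun x => (hmem _).2 (norm_rho_le hR x)
  have hul : ∀ x y, ‖u x - u y‖ ≤ 2 * C * ‖x - y‖ := fun x y => by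
    have := hvl _ (hrB x) _ (hrB y)
    have h2 := mul_le_mul_of_nonneg_left (rho_lip hR x y) hC0
    linarith
  obtain ⟨δ, hδ, hdet⟩ := exists_det_pos (E := E)
  -- the key identity for small t
  obtain ⟨η, hη, hη1, hηC, hηδ⟩ : ∃ η : ℝ, 0 < η ∧ η ≤ 1 ∧ η * (2 * C) < 1 ∧ η * C < δ := by
    refine ⟨min 1 (min (1 / (2 * C + 1)) (δ / (C + 1))), by positivity, min_le_left _ _, ?_, ?_⟩
    · have h1 : min 1 (min (1 / (2 * C + 1)) (δ / (C + 1))) ≤ 1 / (2 * C + 1) :=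
        (min_le_right _ _).trans (min_le_left _ _)
      calc _ ≤ 1 / (2 * C + 1) * (2 * C) := by gcongr
        _ < 1 := by rw [div_mul_eq_mul_div, div_lt_one (by positivity)]; linarith
    · have h1 : min 1 (min (1 / (2 * C + 1)) (δ / (C + 1))) ≤ δ / (C + 1) :=
        (min_le_right _ _).trans (min_le_right _ _)
      calc _ ≤ δ / (C + 1) * C := by gcongr
        _ < δ := by rw [div_mul_eq_mul_div, div_lt_iff₀ (by positivity)]; nlinarith
  have key : ∀ t : ℝ, 0 < t → t ≤ η →
      ∫ x in B, (ContinuousLinearMap.id ℝ E + t • fderiv ℝ v x).det = volume.real B := by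
    intro t ht htη
    have htC : t * (2 * C) < 1 := lt_of_le_of_lt (by gcongr) hηC
    have htδ : t * C < δ := lt_of_le_of_lt (by gcongr) hηδ
    let f : E → E := fun x => x + t • v x
    have hinj : InjOn f B := by
      intro x hx y hy hxy
      have h1 : x - y = t • (v y - v x) := by
        have : x + t • v x = y + t • v y := hxy
        rw [smul_sub, sub_eq_sub_iff_add_eq_add, this, add_comm]
      have h2 := hvl y hy x hx
      have h3 : ‖x - y‖ = t * ‖v y - v x‖ := by
        conv_lhs => rw [h1]
        rw [norm_smul, Real.norm_of_nonneg ht.le]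
      rw [norm_sub_rev y x] at h2
      have h4 : ‖x - y‖ ≤ t * C * ‖x - y‖ := by
        rw [mul_assoc]; conv_lhs => rw [h3]
        gcongr
      have h5 := norm_nonneg (x - y)
      have : ‖x - y‖ = 0 := by nlinarith [mul_nonneg ht.le hC0]
      exact sub_eq_zero.1 (norm_eq_zero.1 this)
    have himg : f '' B = B := by
      apply Set.Subset.antisymm
      · rintro _ ⟨x, hx, rfl⟩
        have : f x = (1 - t) • x + t • r x := by simp only [f, v]; module
        rw [hmem] at hx ⊢
        rw [this]
        have ht1 : t ≤ 1 := htη.trans hη1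
        calc _ ≤ _ := norm_add_le _ _
          _ = (1 - t) * ‖x‖ + t * R := by
            rw [norm_smul, norm_smul, Real.norm_of_nonneg ht.le,
              Real.norm_of_nonneg (by linarith), hn]
          _ ≤ _ := by nlinarith
      · intro y hy
        have hcon : ContractingWith (⟨t * (2 * C), by positivity⟩ : NNReal)
            (fun x => y - t • u x) := by
          refine ⟨by exact_mod_cast htC, LipschitzWith.of_dist_le_mul fun a b => ?_⟩
          rw [dist_eq_norm, dist_eq_norm]
          have : y - t • u a - (y - t • u b) = t • (u b - u a) := by module
          rw [this, norm_smul, Real.norm_of_nonneg ht.le]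
          have := hul b a
          rw [norm_sub_rev b a] at this
          calc _ ≤ t * (2 * C * ‖a - b‖) := by gcongr
            _ = t * (2 * C) * ‖a - b‖ := by ring
        obtain ⟨x, hx, -⟩ := hcon.exists_fixedPoint y (edist_ne_top _ _)
        have hx' : y - t • u x = x := hx
        have hxB : x ∈ B := by
          by_contra hxB
          have hxR : R ≤ ‖x‖ := by
            rw [hmem] at hxB; exact (not_le.1 hxB).le
          have : u x = 0 := by
            simp only [u, v]
            rw [hid _ (norm_rho_of_ge hR hxR), sub_self]
          rw [this, smul_zero, sub_zero] at hx'
          exact hxB (hx' ▸ hy)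
        refine ⟨x, hxB, ?_⟩
        have : u x = v x := by
          simp only [u]; rw [rho_of_le hR ((hmem x).1 hxB)]
        rw [this] at hx'
        simp only [f]
        rw [← sub_eq_iff_eq_add.1 hx']
    have hfd : ∀ x ∈ B, HasFDerivWithinAt f
        (ContinuousLinearMap.id ℝ E + t • fderiv ℝ v x) B x := fun x _ =>
      ((hasFDerivAt_id x).add ((hvd x).hasFDerivAt.const_smul t)).hasFDerivWithinAt
    have h := integral_image_eq_integral_abs_det_fderiv_smul volume hBc.measurableSet hfd hinj
      (fun _ => (1 : ℝ))
    rw [himg] at h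
    simp only [smul_eq_mul, mul_one, integral_const, MeasurableSet.univ, measureReal_restrict_apply,
      Set.univ_inter] at h
    rw [h]
    refine setIntegral_congr_fun hBc.measurableSet fun x hx => ?_
    have hp := hdet (t • fderiv ℝ v x) (by
      rw [norm_smul, Real.norm_of_nonneg ht.le]
      exact lt_of_le_of_lt (by gcongr; exact hC x hx) htδ)
    exact (abs_of_pos hp).symm
  -- interpolate
  obtain ⟨s, hsub, hcard⟩ := (Ioc_infinite hη).exists_subset_card_eq (Module.finrank ℝ E + 1)
  have hint : ∀ t : ℝ, IntegrableOn
      (fun x => (ContinuousLinearMap.id ℝ E + t • fderiv ℝ v x).det) B := fun t =>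
    (ContinuousLinearMap.continuous_det.comp (by fun_prop)).continuousOn.integrableOn_compact hBc
  have hone : ∫ x in B, (ContinuousLinearMap.id ℝ E + fderiv ℝ v x).det = volume.real B := by
    have : ∀ x, (ContinuousLinearMap.id ℝ E + fderiv ℝ v x).det = _ :=
      fun x => det_interp (fderiv ℝ v x) s (by omega)
    simp_rw [this]
    rw [integral_finsetSum _ fun t _ => (hint t).mul_const _]
    simp_rw [integral_mul_const]
    rw [Finset.sum_congr rfl fun t ht => by rw [key t (hsub ht).1 (hsub ht).2],
      ← Finset.mul_sum, ← Polynomial.eval_finsetSum,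
      Lagrange.sum_basis Function.injective_id.injOn (Finset.card_pos.1 (by omega))]
    simp
  have hzero : ∀ x, (ContinuousLinearMap.id ℝ E + fderiv ℝ v x).det = 0 := by
    intro x
    have hrx : HasFDerivAt r (fderiv ℝ r x) x := (hr.differentiable (by norm_num) x).hasFDerivAt
    have hvx : ContinuousLinearMap.id ℝ E + fderiv ℝ v x = fderiv ℝ r x := by
      have : fderiv ℝ v x = fderiv ℝ r x - ContinuousLinearMap.id ℝ E :=
        (hrx.sub (hasFDerivAt_id x)).fderiv
      rw [this]; abel
    rw [hvx]
    by_contra hne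
    have hsurj : Function.Surjective (fderiv ℝ r x) := by
      have := (LinearMap.equivOfDetNeZero (fderiv ℝ r x : E →ₗ[ℝ] E) hne).surjective
      exact this
    obtain ⟨w, hw⟩ := hsurj (r x)
    have h1 := hrx.inner ℝ hrx
    have h2 : (fun y => inner ℝ (r y) (r y)) = fun _ => R ^ 2 := by
      ext y; rw [real_inner_self_eq_norm_sq, hn]
    rw [h2] at h1
    have h3 := congrArg (fun L => L w) (h1.unique (hasFDerivAt_const _ _))
    simp [fderivInnerCLM_apply, hw] at h3
    have := hn x
    rw [h3, norm_zero] at this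
    exact hR.ne this
  simp_rw [hzero] at hone
  simp only [integral_zero] at hone
  have : 0 < volume.real B := by
    rw [measureReal_def]
    exact ENNReal.toReal_pos (measure_closedBall_pos volume 0 hR).ne' hBc.measure_lt_top.ne
  exact this.ne hone
end

section
variable {E : Type*} [NormedAddCommGroup E] [InnerProductSpace ℝ E] [FiniteDimensional ℝ E]

lemma zero_of_id_outside {R : ℝ} (hR : 0 < R) (F : E → E) (hF : Continuous F)
    (hout : ∀ x, R ≤ ‖x‖ → F x = x) : ∃ x, F x = 0 := by
  by_contra! hne
  borelize E
  obtain ⟨m, hm, hFm⟩ : ∃ m > 0, ∀ x, m ≤ ‖F x‖ := by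
    obtain ⟨x₀, -, hx₀⟩ := (isCompact_closedBall (0 : E) R).exists_isMinOn
      ⟨0, by simp [hR.le]⟩ hF.norm.continuousOn
    refine ⟨min R ‖F x₀‖, lt_min hR (norm_pos_iff.2 (hne _)), fun x => ?_⟩
    rcases le_total R ‖x‖ with h | h
    · rw [hout x h]; exact (min_le_left _ _).trans h
    · exact (min_le_right _ _).trans (hx₀ (by simpa using h))
  let u : E → E := fun x => F x - x
  have huc : Continuous u := hF.sub continuous_id
  have hu0 : ∀ x, R ≤ ‖x‖ → u x = 0 := fun x hx => by simp [u, hout x hx]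
  have hcs : HasCompactSupport u := HasCompactSupport.intro (isCompact_closedBall (0 : E) R)
    fun x hx => hu0 x (by simp at hx; exact hx.le)
  have huu : UniformContinuous u := hcs.uniformContinuous_of_continuous huc
  obtain ⟨δ, hδ, hδu⟩ := Metric.uniformContinuous_iff.mp huu (m / 2) (half_pos hm)
  obtain ⟨g, hg, hgu⟩ := huc.exists_contDiff_dist_le_of_forall_mem_ball_dist_le (lt_min hδ hR)
  have hg1 : ∀ a, ‖g a - u a‖ ≤ m / 2 := fun a => by
    rw [← dist_eq_norm]
    exact hgu a _ fun x hx => (hδu (lt_of_lt_of_le hx (min_le_left _ _))).le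
  have hg0 : ∀ a, ‖a‖ = 2 * R → g a = 0 := fun a ha => by
    have h1 := hgu a 0 fun x hx => by
      have hx' : ‖x - a‖ < R := by
        rw [← dist_eq_norm]; exact lt_of_lt_of_le hx (min_le_right _ _)
      have := norm_sub_norm_le a x
      rw [norm_sub_rev] at this
      rw [hu0 x (by linarith), hu0 a (by linarith), dist_self]
    have h2 := dist_le_zero.1 h1
    rw [h2, hu0 a (by linarith)]
  let G : E → E := fun x => x + g x
  have hGd : ContDiff ℝ 1 G := contDiff_id.add (hg.of_le (by exact_mod_cast le_top))
  have hG0 : ∀ x, G x ≠ 0 := fun x hx => by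
    have h1 : F x = - (g x - u x) := by
      have : G x = F x + (g x - u x) := by simp only [G, u]; abel
      rw [hx] at this
      exact eq_neg_of_add_eq_zero_left this.symm
    have h2 := hFm x
    rw [h1, norm_neg] at h2
    linarith [hg1 x]
  refine no_retract (R := 2 * R) (by positivity) (fun x => ((2 * R) * ‖G x‖⁻¹) • G x) ?_ ?_ ?_
  · exact (contDiff_const.mul ((hGd.norm ℝ hG0).inv fun x => norm_ne_zero_iff.2 (hG0 x))).smul hGd
  · intro x
    have := norm_pos_iff.2 (hG0 x)
    rw [norm_smul, Real.norm_of_nonneg (by positivity)]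
    field_simp
  · intro x hx
    have : G x = x := by simp [G, hg0 x hx]
    simp only [this, hx]
    rw [mul_inv_cancel₀ (by positivity), one_smul]
end

lemma zero_in_ball {X : Type*} [NormedAddCommGroup X] [NormedSpace ℝ X] [FiniteDimensional ℝ X]
    {R : ℝ} (hR : 0 < R) (Φ : X → X) (hΦ : ContinuousOn Φ (closedBall 0 R))
    (hb : ∀ t, ‖t‖ = R → ‖Φ t - t‖ < R) : ∃ t, ‖t‖ ≤ R ∧ Φ t = 0 := by
  let l : X → ℝ := fun x => max 0 (min 1 (2 - ‖x‖ / R))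
  let F : X → X := fun x => x + l x • (Φ (rho R x) - rho R x)
  have hρ := continuous_rho (E := X) hR
  have hΦρ : Continuous fun x => Φ (rho R x) :=
    hΦ.comp_continuous hρ fun x => by simpa using norm_rho_le hR x
  have hFc : Continuous F := by
    have hl : Continuous l := by fun_prop
    exact continuous_id.add (hl.smul (hΦρ.sub hρ))
  have hF2 : ∀ x, 2 * R ≤ ‖x‖ → F x = x := fun x hx => by
    have : l x = 0 := by
      have : 2 ≤ ‖x‖ / R := (le_div_iff₀ hR).2 hx
      exact max_eq_left ((min_le_right _ _).trans (by linarith))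
    simp [F, this]
  let e := toEuclidean (E := X)
  obtain ⟨S, hS⟩ := (isCompact_closedBall (0 : X) (2 * R)).exists_bound_of_continuousOn
    (f := e) e.continuous.continuousOn
  obtain ⟨z, hz⟩ := zero_of_id_outside (R := max 1 (S + 1)) (by positivity)
    (fun y => e (F (e.symm y)))
    (e.continuous.comp (hFc.comp e.symm.continuous)) (by
      intro y hy
      rw [hF2, e.apply_symm_apply]
      by_contra h
      have h1 := hS (e.symm y) (by simpa using (not_le.1 h).le)
      rw [e.apply_symm_apply] at h1
      linarith [le_max_right 1 (S + 1)])
  have hz' : F (e.symm z) = 0 := by simpa using hz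
  set x := e.symm z
  have hxR : ‖x‖ ≤ R := by
    by_contra hx
    have hx := not_le.1 hx
    have h1 := hb _ (norm_rho_of_ge hR hx.le)
    have h2 : x = - (l x • (Φ (rho R x) - rho R x)) := eq_neg_of_add_eq_zero_left hz'
    have hl0 : 0 ≤ l x := le_max_left _ _
    have hl1 : l x ≤ 1 := max_le zero_le_one (min_le_left _ _)
    have h3 : ‖x‖ = l x * ‖Φ (rho R x) - rho R x‖ := by
      conv_lhs => rw [h2]
      rw [norm_neg, norm_smul, Real.norm_of_nonneg hl0]
    have := mul_le_of_le_one_left (norm_nonneg (Φ (rho R x) - rho R x)) hl1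
    linarith
  refine ⟨x, hxR, ?_⟩
  have hl : l x = 1 := by
    have : ‖x‖ / R ≤ 1 := (div_le_one hR).2 hxR
    simp only [l]
    rw [min_eq_left (by linarith), max_eq_right zero_le_one]
  simpa [F, hl, rho_of_le hR hxR] using hz'

section
variable {X Y : Type*} [NormedAddCommGroup X] [NormedSpace ℝ X]
    [NormedAddCommGroup Y] [NormedSpace ℝ Y]

lemma abs_rpow_sub_le {α a b : ℝ} (h0 : 0 < α) (h1 : α ≤ 1) (ha : 0 ≤ a) (hb : 0 ≤ b) :
    |a ^ α - b ^ α| ≤ |a - b| ^ α := by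
  wlog hab : b ≤ a generalizing a b
  · rw [abs_sub_comm, abs_sub_comm a]; exact this hb ha (le_of_not_ge hab)
  rw [abs_of_nonneg (sub_nonneg.2 hab),
    abs_of_nonneg (sub_nonneg.2 (Real.rpow_le_rpow hb hab h0.le))]
  have := Real.rpow_add_le_add_rpow (sub_nonneg.2 hab) hb h0.le h1
  rw [sub_add_cancel] at this
  linarith

lemma unit_norm {x : X} (hx : x ≠ 0) : ‖‖x‖⁻¹ • x‖ = 1 := by
  rw [norm_smul, norm_inv, norm_norm, inv_mul_cancel₀ (norm_ne_zero_iff.2 hx)]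

lemma norm_radial {α : ℝ} (h0 : 0 < α) {f : X → Y} (hf : ∀ x, ‖x‖ = 1 → ‖f x‖ = 1) (x : X) :
    ‖radialExt α f x‖ = ‖x‖ ^ α := by
  unfold radialExt
  split_ifs with h
  · simp [h, Real.zero_rpow h0.ne']
  · rw [norm_smul, hf _ (unit_norm h), mul_one, Real.norm_of_nonneg (by positivity)]

lemma radial_holder {α K : ℝ} (h0 : 0 < α) (h1 : α ≤ 1) (hK : 0 < K) {f : X → Y}
    (hf : ∀ x, ‖x‖ = 1 → ‖f x‖ = 1)
    (hh : ∀ x y : X, ‖x‖ = 1 → ‖y‖ = 1 → ‖f x - f y‖ ≤ K * ‖x - y‖ ^ α) (x y : X) :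
    ‖radialExt α f x - radialExt α f y‖ ≤ (1 + (2 : ℝ) ^ α * K) * ‖x - y‖ ^ α := by
  have hbig : ∀ z : X, ‖z‖ ^ α ≤ (1 + (2 : ℝ) ^ α * K) * ‖z‖ ^ α := fun z =>
    le_mul_of_one_le_left (by positivity) (by
      have : 0 ≤ (2 : ℝ) ^ α * K := by positivity
      linarith)
  by_cases hx : x = 0
  · have : radialExt α f x = 0 := by simp [radialExt, hx]
    rw [this, hx, zero_sub, zero_sub, norm_neg, norm_neg, norm_radial h0 hf]
    exact hbig y
  by_cases hy : y = 0
  · have : radialExt α f y = 0 := by simp [radialExt, hy]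
    rw [this, hy, sub_zero, sub_zero, norm_radial h0 hf]
    exact hbig x
  have hx0 := norm_pos_iff.2 hx
  have hy0 := norm_pos_iff.2 hy
  have nx : ‖‖x‖⁻¹ • x‖ = 1 := unit_norm hx
  have ny : ‖‖y‖⁻¹ • y‖ = 1 := unit_norm hy
  have e : radialExt α f x - radialExt α f y = ‖x‖ ^ α • (f (‖x‖⁻¹ • x) - f (‖y‖⁻¹ • y))
      + (‖x‖ ^ α - ‖y‖ ^ α) • f (‖y‖⁻¹ • y) := by
    simp only [radialExt, hx, hy, if_false]; module
  have a1 : ‖(‖x‖ ^ α - ‖y‖ ^ α) • f (‖y‖⁻¹ • y)‖ ≤ ‖x - y‖ ^ α := by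
    rw [norm_smul, hf _ ny, mul_one, Real.norm_eq_abs]
    refine (abs_rpow_sub_le h0 h1 hx0.le hy0.le).trans ?_
    exact Real.rpow_le_rpow (abs_nonneg _) (abs_norm_sub_norm_le x y) h0.le
  have a3 : ‖x‖ * ‖‖x‖⁻¹ • x - ‖y‖⁻¹ • y‖ ≤ 2 * ‖x - y‖ := by
    have : ‖x‖ * ‖‖x‖⁻¹ • x - ‖y‖⁻¹ • y‖ = ‖(x - y) + ((‖y‖ - ‖x‖) * ‖y‖⁻¹) • y‖ := by
      rw [← Real.norm_of_nonneg hx0.le, ← norm_smul, Real.norm_of_nonneg hx0.le]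
      congr 1
      rw [smul_sub, smul_smul, smul_smul, mul_inv_cancel₀ hx0.ne', one_smul, sub_mul,
        mul_inv_cancel₀ hy0.ne', sub_smul, one_smul]
      abel
    rw [this]
    have b1 := norm_add_le (x - y) (((‖y‖ - ‖x‖) * ‖y‖⁻¹) • y)
    have b2 : ‖((‖y‖ - ‖x‖) * ‖y‖⁻¹) • y‖ ≤ ‖x - y‖ := by
      rw [mul_smul, norm_smul, ny, mul_one, norm_sub_rev x y]
      exact abs_norm_sub_norm_le y x
    linarith
  have a2 : ‖‖x‖ ^ α • (f (‖x‖⁻¹ • x) - f (‖y‖⁻¹ • y))‖ ≤ (2 : ℝ) ^ α * K * ‖x - y‖ ^ α := by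
    rw [norm_smul, Real.norm_of_nonneg (by positivity)]
    calc _ ≤ ‖x‖ ^ α * (K * ‖‖x‖⁻¹ • x - ‖y‖⁻¹ • y‖ ^ α) := by
          gcongr; exact hh _ _ nx ny
      _ = K * (‖x‖ * ‖‖x‖⁻¹ • x - ‖y‖⁻¹ • y‖) ^ α := by
          rw [Real.mul_rpow hx0.le (norm_nonneg _)]; ring
      _ ≤ K * (2 * ‖x - y‖) ^ α := by
          gcongr
      _ = _ := by rw [Real.mul_rpow (by norm_num) (norm_nonneg _)]; ring
  rw [e]
  have := norm_add_le (‖x‖ ^ α • (f (‖x‖⁻¹ • x) - f (‖y‖⁻¹ • y)))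
    ((‖x‖ ^ α - ‖y‖ ^ α) • f (‖y‖⁻¹ • y))
  linarith

lemma continuous_of_holder {α C : ℝ} (h0 : 0 < α) {g : X → Y}
    (h : ∀ x y, ‖g x - g y‖ ≤ C * ‖x - y‖ ^ α) : Continuous g := by
  refine continuous_iff_continuousAt.2 fun a => ?_
  rw [ContinuousAt, tendsto_iff_norm_sub_tendsto_zero]
  refine squeeze_zero (fun _ => norm_nonneg _) (fun x => h x a) ?_
  have : Continuous fun x : X => C * ‖x - a‖ ^ α :=
    continuous_const.mul (Continuous.rpow_const (by fun_prop) fun _ => Or.inr h0.le)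
  simpa [Real.zero_rpow h0.ne'] using this.tendsto a

end
end Aux

/-- There is a universal constant `c ≥ 1` such that for every bi-Hölder homeomorphism
`f` between the unit spheres of finite-dimensional real normed spaces `X` and `Y` and
every finite nonempty `P ⊆ X`, there is a shift `t` (of controlled norm) such that
`g(x) = f̃(x - t)` is `(1 + 2^α K)`-Hölder of exponent `α` and embeds the `α`-snowflake
of `X` into `Y` with average distortion `O(1 + K)` with respect to `P`. -/
theorem stmt16 :
    ∃ c : ℝ, 1 ≤ c ∧
      ∀ (α β K L : ℝ), 0 < α → α ≤ 1 → 0 < β → β ≤ 1 → 0 < K → 0 < L →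
      ∃ M : ℝ, 0 < M ∧
        ∀ (X : Type u) (Y : Type v)
          [instX : NormedAddCommGroup X] [instX' : NormedSpace ℝ X]
          [instX'' : FiniteDimensional ℝ X]
          [instY : NormedAddCommGroup Y] [instY' : NormedSpace ℝ Y]
          [instY'' : FiniteDimensional ℝ Y]
          (f : X → Y) (finv : Y → X),
          (∀ x : X, ‖x‖ = 1 → ‖f x‖ = 1) →
          (∀ y : Y, ‖y‖ = 1 → ‖finv y‖ = 1) →
          (∀ x : X, ‖x‖ = 1 → finv (f x) = x) →
          (∀ y : Y, ‖y‖ = 1 → f (finv y) = y) →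
          (∀ x y : X, ‖x‖ = 1 → ‖y‖ = 1 →
            (1 / L) * ‖x - y‖ ^ (1 / β) ≤ ‖f x - f y‖ ∧
              ‖f x - f y‖ ≤ K * ‖x - y‖ ^ α) →
          ∀ (P : Finset X), P.Nonempty →
            ∃ t : X,
              ‖t‖ ≤ ((M / (P.card : ℝ)) * ∑ x ∈ P, ‖x‖ ^ α) ^ (1 / α) ∧
              (∀ x y : X,
                ‖radialExt α f (x - t) - radialExt α f (y - t)‖ ≤
                  (1 + (2 : ℝ) ^ α * K) * ‖x - y‖ ^ α) ∧
              ∑ x ∈ P, ∑ y ∈ P, ‖radialExt α f (x - t) - radialExt α f (y - t)‖ ≥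
                (1 / c) * ∑ x ∈ P, ∑ y ∈ P, ‖x - y‖ ^ α := by
  
  refine ⟨2, by norm_num, ?_⟩
  intro α β K L hα hα1 hβ hβ1 hK hL
  set Q : ℝ := 1 + (2 : ℝ) ^ α * K with hQ
  have hQ0 : 0 < Q := by positivity
  refine ⟨2 * Q * L + 1, by positivity, ?_⟩
  set M : ℝ := 2 * Q * L + 1 with hM
  have hM0 : 0 < M := by positivity
  intro X Y _ _ _ _ _ _ f finv hf hfinv hl hr hh P hP
  have hol := Aux.radial_holder hα hα1 hK hf (fun x y hx hy => (hh x y hx hy).2)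
  have hcont : Continuous (radialExt α f) := Aux.continuous_of_holder hα hol
  have hn : (0 : ℝ) < P.card := by exact_mod_cast hP.card_pos
  set A : ℝ := ∑ x ∈ P, ‖x‖ ^ α with hA
  have hA0 : 0 ≤ A := Finset.sum_nonneg fun x _ => by positivity
  set R : ℝ := ((M / (P.card : ℝ)) * A) ^ (1 / α) with hR
  have hR0 : 0 ≤ R := by positivity
  have hRα : R ^ α = (M / (P.card : ℝ)) * A := by
    rw [hR, ← Real.rpow_mul (by positivity), one_div_mul_cancel hα.ne', Real.rpow_one]
  -- existence of a centering shift
  obtain ⟨t, htR, ht⟩ : ∃ t : X, ‖t‖ ≤ R ∧ ∑ x ∈ P, radialExt α f (x - t) = 0 := by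
    rcases hA0.eq_or_lt with hA' | hA'
    · refine ⟨0, by simpa using hR0, Finset.sum_eq_zero fun x hx => ?_⟩
      have h1 := (Finset.sum_eq_zero_iff_of_nonneg (s := P) (f := fun x : X => ‖x‖ ^ α)
        (fun x _ => by positivity)).1 hA'.symm x hx
      rw [← norm_eq_zero, Aux.norm_radial hα hf, sub_zero]
      exact h1
    have hRpos : 0 < R := by positivity
    by_contra! hne
    let h : X → Y := fun t => ∑ x ∈ P, radialExt α f (x - t)
    have hc : Continuous h := continuous_finsetSum _ fun x _ => hcont.comp (by fun_prop)
    have hfc : ∀ y z : Y, ‖y‖ = 1 → ‖z‖ = 1 → ‖finv y - finv z‖ ≤ (L * ‖y - z‖) ^ β := by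
      intro y z hy hz
      have h1 := (hh _ _ (hfinv y hy) (hfinv z hz)).1
      rw [hr y hy, hr z hz] at h1
      have h2 : ‖finv y - finv z‖ ^ (1 / β) ≤ L * ‖y - z‖ := by
        rw [one_div_mul_eq_div, div_le_iff₀ hL] at h1
        linarith
      calc ‖finv y - finv z‖ = (‖finv y - finv z‖ ^ (1 / β)) ^ β := by
            rw [← Real.rpow_mul (norm_nonneg _), one_div_mul_cancel hβ.ne', Real.rpow_one]
        _ ≤ _ := Real.rpow_le_rpow (by positivity) h2 hβ.le
    have hfcont : ContinuousOn finv (Metric.sphere 0 1) := by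
      intro y hy
      have hy' : ‖y‖ = 1 := by simpa using hy
      rw [ContinuousWithinAt, tendsto_iff_norm_sub_tendsto_zero]
      refine squeeze_zero' (Filter.Eventually.of_forall fun _ => norm_nonneg _)
        (g := fun z => (L * ‖z - y‖) ^ β) ?_ ?_
      · filter_upwards [self_mem_nhdsWithin] with z hz
        exact hfc z y (by simpa using hz) hy'
      · have : Continuous fun z : Y => (L * ‖z - y‖) ^ β :=
          Continuous.rpow_const (by fun_prop) fun _ => Or.inr hβ.le
        have h3 := this.tendsto y
        simp only [sub_self, norm_zero, mul_zero, Real.zero_rpow hβ.ne'] at h3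
        exact h3.mono_left nhdsWithin_le_nhds
    let Φ : X → X := fun t => -(R • finv (‖h t‖⁻¹ • h t))
    obtain ⟨t, htR, ht⟩ := Aux.zero_in_ball hRpos Φ (by
      refine ContinuousOn.neg (ContinuousOn.const_smul (hfcont.comp ?_ ?_) R)
      · refine ContinuousOn.smul (ContinuousOn.inv₀ hc.norm.continuousOn fun t ht => ?_)
          hc.continuousOn
        exact norm_ne_zero_iff.2 (hne t (by simpa using ht))
      · intro t ht
        simpa using Aux.unit_norm (hne t (by simpa using ht))) (by
      intro t ht
      have ht0 : h t ≠ 0 := hne t ht.le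
      have htne : -t ≠ 0 := by
        rw [neg_ne_zero, ← norm_ne_zero_iff, ht]; exact hRpos.ne'
      set w : Y := f (R⁻¹ • (-t)) with hw
      have hun : ‖R⁻¹ • (-t)‖ = 1 := by
        have := Aux.unit_norm htne
        rwa [norm_neg, ht] at this
      have hw1 : ‖w‖ = 1 := hf _ hun
      have hrad : radialExt α f (-t) = R ^ α • w := by
        rw [radialExt, if_neg htne, norm_neg, ht]
      -- distance of `h t` to `n R^α w`
      set T : ℝ := P.card * R ^ α with hT
      have hTM : T = M * A := by rw [hT, hRα]; field_simp
      have hT0 : 0 < T := by positivity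
      have hd : ‖h t - T • w‖ ≤ Q * A := by
        have e1 : h t - T • w = ∑ x ∈ P, (radialExt α f (x - t) - radialExt α f (-t)) := by
          rw [Finset.sum_sub_distrib, Finset.sum_const, hrad, hT, ← Nat.cast_smul_eq_nsmul ℝ,
            smul_smul]
        rw [e1, hA, Finset.mul_sum]
        refine norm_sum_le_of_le _ fun x _ => ?_
        have := hol (x - t) (-t)
        rwa [sub_neg_eq_add, sub_add_cancel] at this
      set u : Y := ‖h t‖⁻¹ • h t with hu
      have hu1 : ‖u‖ = 1 := Aux.unit_norm ht0
      have huh : ‖h t‖ • u = h t := by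
        rw [hu, smul_smul, mul_inv_cancel₀ (norm_ne_zero_iff.2 ht0), one_smul]
      have huw : T * ‖u - w‖ ≤ 2 * (Q * A) := by
        have e2 : T • (u - w) = (T - ‖h t‖) • u + (h t - T • w) := by
          conv_rhs => rw [← huh]
          rw [huh]
          conv_rhs => rw [sub_smul, huh]
          rw [smul_sub]; abel
        have e3 : T * ‖u - w‖ = ‖T • (u - w)‖ := by
          rw [norm_smul, Real.norm_of_nonneg hT0.le]
        have e4 : ‖(T - ‖h t‖) • u‖ ≤ ‖h t - T • w‖ := by
          rw [norm_smul, hu1, mul_one, Real.norm_eq_abs, norm_sub_rev]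
          have := abs_norm_sub_norm_le (T • w) (h t)
          rwa [norm_smul, hw1, mul_one, Real.norm_of_nonneg hT0.le] at this
        rw [e3, e2]
        have := norm_add_le ((T - ‖h t‖) • u) (h t - T • w)
        linarith
      have hLu : L * ‖u - w‖ < 1 := by
        rw [hTM] at huw
        have h5 : M * ‖u - w‖ ≤ 2 * Q := by
          have : A * (M * ‖u - w‖) ≤ A * (2 * Q) := by linarith
          exact le_of_mul_le_mul_left this hA'
        have h6 : M * (L * ‖u - w‖) < M := by
          calc M * (L * ‖u - w‖) = L * (M * ‖u - w‖) := by ring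
            _ ≤ L * (2 * Q) := by gcongr
            _ < M := by rw [hM]; linarith
        by_contra hcon
        nlinarith [not_lt.1 hcon]
      have hfin : finv w = R⁻¹ • (-t) := hl _ hun
      have e5 : Φ t - t = -(R • (finv u - finv w)) := by
        rw [hfin, smul_sub, smul_smul, mul_inv_cancel₀ hRpos.ne', one_smul]
        simp only [Φ, ← hu]; abel
      rw [e5, norm_neg, norm_smul, Real.norm_of_nonneg hR0]
      have h7 : ‖finv u - finv w‖ < 1 :=
        (hfc u w hu1 hw1).trans_lt (Real.rpow_lt_one (by positivity) hLu hβ)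
      nlinarith)
    have h8 := hfinv _ (Aux.unit_norm (hne t htR))
    have h9 : R • finv (‖h t‖⁻¹ • h t) = 0 := neg_eq_zero.1 ht
    rcases smul_eq_zero.1 h9 with h10 | h10
    · exact hRpos.ne' h10
    · change ‖finv (‖h t‖⁻¹ • h t)‖ = 1 at h8
      rw [h10, norm_zero] at h8
      exact zero_ne_one h8
  refine ⟨t, htR, ?_, ?_⟩
  · intro x y
    have := hol (x - t) (y - t)
    rwa [sub_sub_sub_cancel_right] at this
  · set S : ℝ := ∑ x ∈ P, ‖x - t‖ ^ α with hS
    have lower : P.card * S ≤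
        ∑ x ∈ P, ∑ y ∈ P, ‖radialExt α f (x - t) - radialExt α f (y - t)‖ := by
      rw [hS, Finset.mul_sum]
      refine Finset.sum_le_sum fun x _ => ?_
      have e1 : ∑ y ∈ P, (radialExt α f (x - t) - radialExt α f (y - t))
          = (P.card : ℝ) • radialExt α f (x - t) := by
        rw [Finset.sum_sub_distrib, ht, sub_zero, Finset.sum_const, Nat.cast_smul_eq_nsmul]
      calc _ = ‖(P.card : ℝ) • radialExt α f (x - t)‖ := by
            rw [norm_smul, Aux.norm_radial hα hf, Real.norm_of_nonneg hn.le]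
        _ ≤ _ := by rw [← e1]; exact norm_sum_le _ _
    have upper : ∑ x ∈ P, ∑ y ∈ P, ‖x - y‖ ^ α ≤ 2 * (P.card * S) := by
      calc _ ≤ ∑ x ∈ P, ∑ y ∈ P, (‖x - t‖ ^ α + ‖y - t‖ ^ α) := by
            refine Finset.sum_le_sum fun x _ => Finset.sum_le_sum fun y _ => ?_
            refine (Real.rpow_le_rpow (norm_nonneg _) ?_ hα.le).trans
              (Real.rpow_add_le_add_rpow (norm_nonneg _) (norm_nonneg _) hα.le hα1)
            have := norm_sub_le (x - t) (y - t)
            rwa [sub_sub_sub_cancel_right] at this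
        _ = _ := by
            simp only [Finset.sum_add_distrib, Finset.sum_const, nsmul_eq_mul, ← Finset.mul_sum]
            rw [← hS]; ring
    linarith
end

section
/- Let p ≥ 1 and set q = p/2 + 1. Let P be a finite set of n real symmetric d×d matrices, and define f on the space of real symmetric d×d matrices by f(T) = (1/n) Σ_{X∈P} ‖X − T‖_{C_q}^q. Then f is a convex function, and if T is a real symmetric d×d matrix minimizing f over all real symmetric d×d matrices, then (1/n) Σ_{X∈P} M_{p,2}(X − T) = 0. -/
open Finset Matrix
open scoped Classical

variable {d : ℕ}

/-- The Schatten-`q` norm of a real symmetric (Hermitian) `d×d` matrix: the ℓ_q norm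
of its eigenvalues. (Defined to be `0` on non-Hermitian matrices.) -/
noncomputable def schattenNorm (q : ℝ) (X : Matrix (Fin d) (Fin d) ℝ) : ℝ :=
  if h : X.IsHermitian then (∑ i, |h.eigenvalues i| ^ q) ^ (1 / q) else 0

/-- The non-commutative Mazur map `M_{p,2}` on real symmetric matrices: if
`X = Σ_i λ_i u_i u_iᵀ` is a spectral decomposition, then
`M_{p,2}(X) = Σ_i sign(λ_i) |λ_i|^{p/2} u_i u_iᵀ`. (Defined to be `0` on
non-Hermitian matrices.) -/
noncomputable def ncMazurMap (p : ℝ) (X : Matrix (Fin d) (Fin d) ℝ) :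
    Matrix (Fin d) (Fin d) ℝ :=
  if h : X.IsHermitian then
    (h.eigenvectorUnitary : Matrix (Fin d) (Fin d) ℝ) *
      Matrix.diagonal (fun i => Real.sign (h.eigenvalues i) * |h.eigenvalues i| ^ (p / 2)) *
      star (h.eigenvectorUnitary : Matrix (Fin d) (Fin d) ℝ)
  else 0

open Filter Topology

/-- apply a real function to a Hermitian matrix -/
noncomputable def hfun (f : ℝ → ℝ) {X : Matrix (Fin d) (Fin d) ℝ} (h : X.IsHermitian) :
    Matrix (Fin d) (Fin d) ℝ :=
  (h.eigenvectorUnitary : Matrix (Fin d) (Fin d) ℝ) *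
      Matrix.diagonal (fun i => f (h.eigenvalues i)) *
      star (h.eigenvectorUnitary : Matrix (Fin d) (Fin d) ℝ)

theorem hfun_id {X : Matrix (Fin d) (Fin d) ℝ} (h : X.IsHermitian) :
    hfun (fun x => x) h = X := by
  have := h.spectral_theorem
  conv_rhs => rw [this]
  simp [hfun, Unitary.conjStarAlgAut_apply]

theorem hfun_isHermitian (f : ℝ → ℝ) {X : Matrix (Fin d) (Fin d) ℝ} (h : X.IsHermitian) :
    (hfun f h).IsHermitian := by
  unfold hfun
  rw [star_eq_conjTranspose]
  apply isHermitian_mul_mul_conjTranspose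
  exact isHermitian_diagonal _

theorem hfun_mul (f g : ℝ → ℝ) {X : Matrix (Fin d) (Fin d) ℝ} (h : X.IsHermitian) :
    hfun f h * hfun g h = hfun (fun x => f x * g x) h := by
  unfold hfun
  have hU : star (h.eigenvectorUnitary : Matrix (Fin d) (Fin d) ℝ) *
    (h.eigenvectorUnitary : Matrix (Fin d) (Fin d) ℝ) = 1 := Unitary.coe_star_mul_self _
  simp only [Matrix.mul_assoc]
  rw [← Matrix.mul_assoc (star (h.eigenvectorUnitary : Matrix (Fin d) (Fin d) ℝ)), hU,
    Matrix.one_mul, ← Matrix.mul_assoc (diagonal _) (diagonal _), diagonal_mul_diagonal]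

theorem trace_hfun (f : ℝ → ℝ) {X : Matrix (Fin d) (Fin d) ℝ} (h : X.IsHermitian) :
    (hfun f h).trace = ∑ i, f (h.eigenvalues i) := by
  unfold hfun
  have hU : star (h.eigenvectorUnitary : Matrix (Fin d) (Fin d) ℝ) *
    (h.eigenvectorUnitary : Matrix (Fin d) (Fin d) ℝ) = 1 := Unitary.coe_star_mul_self _
  rw [Matrix.trace_mul_comm, ← Matrix.mul_assoc, hU, Matrix.one_mul, trace_diagonal]

/-- overlap weights of two eigenbases -/
noncomputable def ovl {A B : Matrix (Fin d) (Fin d) ℝ} (hA : A.IsHermitian) (hB : B.IsHermitian) :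
    Matrix (Fin d) (Fin d) ℝ :=
  star (hA.eigenvectorUnitary : Matrix (Fin d) (Fin d) ℝ) *
    (hB.eigenvectorUnitary : Matrix (Fin d) (Fin d) ℝ)

theorem ovl_mul_star {A B : Matrix (Fin d) (Fin d) ℝ} (hA : A.IsHermitian) (hB : B.IsHermitian) :
    ovl hA hB * star (ovl hA hB) = 1 := by
  have h : ovl hA hB = ((star hA.eigenvectorUnitary * hB.eigenvectorUnitary :
    unitaryGroup (Fin d) ℝ) : Matrix (Fin d) (Fin d) ℝ) := by simp [ovl]
  rw [h]; exact Unitary.coe_mul_star_self _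

theorem star_mul_ovl {A B : Matrix (Fin d) (Fin d) ℝ} (hA : A.IsHermitian) (hB : B.IsHermitian) :
    star (ovl hA hB) * ovl hA hB = 1 := by
  have h : ovl hA hB = ((star hA.eigenvectorUnitary * hB.eigenvectorUnitary :
    unitaryGroup (Fin d) ℝ) : Matrix (Fin d) (Fin d) ℝ) := by simp [ovl]
  rw [h]; exact Unitary.coe_star_mul_self _

theorem ovl_row {A B : Matrix (Fin d) (Fin d) ℝ} (hA : A.IsHermitian) (hB : B.IsHermitian)
    (i : Fin d) : ∑ j, ovl hA hB i j ^ 2 = 1 := by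
  have := congrFun (congrFun (ovl_mul_star hA hB) i) i
  simpa [Matrix.mul_apply, sq, star_apply] using this

theorem ovl_col {A B : Matrix (Fin d) (Fin d) ℝ} (hA : A.IsHermitian) (hB : B.IsHermitian)
    (j : Fin d) : ∑ i, ovl hA hB i j ^ 2 = 1 := by
  have := congrFun (congrFun (star_mul_ovl hA hB) j) j
  simpa [Matrix.mul_apply, sq, star_apply] using this

theorem trace_cross (f g : ℝ → ℝ) {A B : Matrix (Fin d) (Fin d) ℝ}
    (hA : A.IsHermitian) (hB : B.IsHermitian) :
    (hfun f hA * hfun g hB).trace =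
      ∑ i, ∑ j, ovl hA hB i j ^ 2 * (f (hA.eigenvalues i) * g (hB.eigenvalues j)) := by
  have h1 : (hfun f hA * hfun g hB).trace =
      ((diagonal (fun i => f (hA.eigenvalues i)) * ovl hA hB) *
        (diagonal (fun i => g (hB.eigenvalues i)) * star (ovl hA hB))).trace := by
    unfold hfun ovl
    rw [star_mul, star_star]
    simp only [Matrix.mul_assoc]
    rw [Matrix.trace_mul_comm]
    simp only [Matrix.mul_assoc]
  rw [h1, Matrix.trace]
  refine Finset.sum_congr rfl fun i _ => ?_
  rw [diag_apply, Matrix.mul_apply]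
  refine Finset.sum_congr rfl fun j _ => ?_
  rw [diagonal_mul, diagonal_mul, star_apply]
  simp only [star_trivial]
  ring

theorem sum_left {A B : Matrix (Fin d) (Fin d) ℝ} (hA : A.IsHermitian) (hB : B.IsHermitian)
    (x : Fin d → ℝ) : ∑ i, x i = ∑ i, ∑ j, ovl hA hB i j ^ 2 * x i := by
  refine Finset.sum_congr rfl fun i _ => ?_
  rw [← Finset.sum_mul, ovl_row, one_mul]

theorem sum_right {A B : Matrix (Fin d) (Fin d) ℝ} (hA : A.IsHermitian) (hB : B.IsHermitian)
    (x : Fin d → ℝ) : ∑ j, x j = ∑ i, ∑ j, ovl hA hB i j ^ 2 * x j := by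
  rw [Finset.sum_comm]
  refine Finset.sum_congr rfl fun i _ => ?_
  rw [← Finset.sum_mul, ovl_col, one_mul]

/-- Klein inequality -/
theorem klein (g m : ℝ → ℝ) (hgm : ∀ a b, g a + m a * (b - a) ≤ g b)
    {A B : Matrix (Fin d) (Fin d) ℝ} (hA : A.IsHermitian) (hB : B.IsHermitian) :
    (hfun g hA).trace + (hfun m hA * (B - A)).trace ≤ (hfun g hB).trace := by
  have e1 : (hfun m hA * B).trace = (hfun m hA * hfun (fun x => x) hB).trace := by rw [hfun_id]
  have e2 : (hfun m hA * A).trace = (hfun m hA * hfun (fun x => x) hA).trace := by rw [hfun_id]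
  rw [Matrix.mul_sub, Matrix.trace_sub, e1, e2, hfun_mul, trace_cross, trace_hfun, trace_hfun,
    trace_hfun, sum_left hA hB (fun i => g (hA.eigenvalues i)),
    sum_left hA hB (fun i => m (hA.eigenvalues i) * hA.eigenvalues i),
    sum_right hA hB (fun i => g (hB.eigenvalues i)),
    ← Finset.sum_sub_distrib, ← Finset.sum_add_distrib]
  refine Finset.sum_le_sum fun i _ => ?_
  rw [← Finset.sum_sub_distrib, ← Finset.sum_add_distrib]
  refine Finset.sum_le_sum fun j _ => ?_
  have := mul_le_mul_of_nonneg_left (hgm (hA.eigenvalues i) (hB.eigenvalues j))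
    (sq_nonneg (ovl hA hB i j))
  linarith

theorem frob (f : ℝ → ℝ) {A B : Matrix (Fin d) (Fin d) ℝ}
    (hA : A.IsHermitian) (hB : B.IsHermitian) :
    ((hfun f hB - hfun f hA) * (hfun f hB - hfun f hA)).trace =
      ∑ i, ∑ j, ovl hA hB i j ^ 2 * (f (hB.eigenvalues j) - f (hA.eigenvalues i)) ^ 2 := by
  rw [Matrix.sub_mul, Matrix.mul_sub, Matrix.mul_sub, Matrix.trace_sub, Matrix.trace_sub,
    Matrix.trace_sub, Matrix.trace_mul_comm (hfun f hB) (hfun f hA), hfun_mul, hfun_mul,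
    trace_cross, trace_hfun, trace_hfun,
    sum_left hA hB (fun i => f (hA.eigenvalues i) * f (hA.eigenvalues i)),
    sum_right hA hB (fun i => f (hB.eigenvalues i) * f (hB.eigenvalues i))]
  simp only [← Finset.sum_sub_distrib]
  refine Finset.sum_congr rfl fun i _ => Finset.sum_congr rfl fun j _ => ?_
  ring

theorem trace_sq {D : Matrix (Fin d) (Fin d) ℝ} (hD : D.IsHermitian) :
    (D * D).trace = ∑ i, ∑ j, D i j ^ 2 := by
  rw [Matrix.trace]
  refine Finset.sum_congr rfl fun i _ => ?_
  rw [diag_apply, Matrix.mul_apply]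
  refine Finset.sum_congr rfl fun j _ => ?_
  have := hD.apply i j
  simp only [star_trivial] at this
  rw [this, sq]

theorem entry_le {D : Matrix (Fin d) (Fin d) ℝ} (hD : D.IsHermitian) (i j : Fin d) :
    D i j ^ 2 ≤ (D * D).trace := by
  rw [trace_sq hD]
  calc D i j ^ 2 ≤ ∑ j, D i j ^ 2 :=
        Finset.single_le_sum (f := fun j => D i j ^ 2) (fun _ _ => sq_nonneg _) (Finset.mem_univ j)
    _ ≤ _ := Finset.single_le_sum (f := fun i => ∑ j, D i j ^ 2)
        (fun _ _ => Finset.sum_nonneg fun _ _ => sq_nonneg _) (Finset.mem_univ i)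

theorem quad_bound (m : ℝ → ℝ) (hm : Continuous m) (a R η : ℝ) (hη : 0 < η) :
    ∃ C, 0 ≤ C ∧ ∀ b, |b| ≤ R → (m b - m a) ^ 2 ≤ η + C * (b - a) ^ 2 := by
  have hc : Continuous fun b => (m b - m a) ^ 2 := by fun_prop
  obtain ⟨δ, hδ, h1⟩ := Metric.continuous_iff.1 hc a η hη
  obtain ⟨K, hK⟩ := (isCompact_Icc (a := -R) (b := R)).bddAbove_image hc.continuousOn
  refine ⟨|K| / δ ^ 2, by positivity, fun b hb => ?_⟩
  by_cases hd : dist b a < δ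
  · have := h1 b hd
    rw [Real.dist_eq, sub_self, zero_pow two_ne_zero, sub_zero, abs_of_nonneg (sq_nonneg _)] at this
    have : 0 ≤ |K| / δ ^ 2 * (b - a) ^ 2 := by positivity
    linarith
  · have h2 : (m b - m a) ^ 2 ≤ K := hK ⟨b, abs_le.1 hb, rfl⟩
    rw [not_lt, Real.dist_eq] at hd
    have h3 : δ ^ 2 ≤ (b - a) ^ 2 := by
      rw [← sq_abs (b - a)]; gcongr
    have h4 : |K| ≤ |K| / δ ^ 2 * (b - a) ^ 2 := by
      rw [div_mul_eq_mul_div, le_div_iff₀ (by positivity)]; gcongr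
    linarith [le_abs_self K]

theorem hfun_tendsto (m : ℝ → ℝ) (hm : Continuous m) {ι : Type*} {l : Filter ι}
    {A : Matrix (Fin d) (Fin d) ℝ} (hA : A.IsHermitian) (B : ι → Matrix (Fin d) (Fin d) ℝ)
    (hB : ∀ t, (B t).IsHermitian) (hl : Tendsto B l (𝓝 A)) :
    Tendsto (fun t => hfun m (hB t)) l (𝓝 (hfun m hA)) := by
  have key : Tendsto (fun t => ((hfun m (hB t) - hfun m hA) * (hfun m (hB t) - hfun m hA)).trace)
      l (𝓝 0) := by
    have hdiff : Tendsto (fun t => ((B t - A) * (B t - A)).trace) l (𝓝 0) := by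
      have hc : Continuous fun X : Matrix (Fin d) (Fin d) ℝ => ((X - A) * (X - A)).trace := by
        fun_prop
      have h := (hc.tendsto A).comp hl
      rw [sub_self, Matrix.mul_zero, Matrix.trace_zero] at h
      exact h
    have hsq : Tendsto (fun t => (B t * B t).trace) l (𝓝 (A * A).trace) := by
      have hc : Continuous fun X : Matrix (Fin d) (Fin d) ℝ => (X * X).trace := by
        fun_prop
      exact (hc.tendsto A).comp hl
    rw [Metric.tendsto_nhds]
    intro ε hε
    set η : ℝ := ε / (2 * (d + 1)) with hηd
    have hη : 0 < η := by positivity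
    set R : ℝ := Real.sqrt ((A * A).trace + 1)
    choose C hC0 hC using fun i => quad_bound m hm (hA.eigenvalues i) R η hη
    set K := ∑ i, C i
    have hK : 0 ≤ K := Finset.sum_nonneg fun i _ => hC0 i
    have ev1 := hdiff.eventually (gt_mem_nhds (show (0 : ℝ) < ε / (2 * (K + 1)) by positivity))
    have ev2 := hsq.eventually (gt_mem_nhds (show (A * A).trace < (A * A).trace + 1 by linarith))
    filter_upwards [ev1, ev2] with t h1 h2
    have hb : ∀ j, |(hB t).eigenvalues j| ≤ R := by
      intro j
      apply Real.abs_le_sqrt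
      have e : (B t * B t).trace = ∑ j, (hB t).eigenvalues j * (hB t).eigenvalues j := by
        rw [← trace_hfun (fun x => x * x), ← hfun_mul, hfun_id]
      have : (hB t).eigenvalues j * (hB t).eigenvalues j ≤
          ∑ j, (hB t).eigenvalues j * (hB t).eigenvalues j :=
        Finset.single_le_sum (f := fun j => (hB t).eigenvalues j * (hB t).eigenvalues j)
          (fun _ _ => mul_self_nonneg _) (Finset.mem_univ j)
      rw [sq]; linarith
    have e2 := frob (fun x => x) hA (hB t)
    rw [hfun_id, hfun_id] at e2
    have hle : ((hfun m (hB t) - hfun m hA) * (hfun m (hB t) - hfun m hA)).trace ≤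
        d * η + K * ((B t - A) * (B t - A)).trace := by
      rw [frob, e2]
      have : (d : ℝ) * η = ∑ i, ∑ j, ovl hA (hB t) i j ^ 2 * η := by
        rw [← sum_left]; simp
      rw [this, Finset.mul_sum, ← Finset.sum_add_distrib]
      refine Finset.sum_le_sum fun i _ => ?_
      rw [Finset.mul_sum, ← Finset.sum_add_distrib]
      refine Finset.sum_le_sum fun j _ => ?_
      have h3 := hC i _ (hb j)
      have h4 : C i ≤ K := Finset.single_le_sum (fun i _ => hC0 i) (Finset.mem_univ i)
      have h5 := mul_le_mul_of_nonneg_right h4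
        (sq_nonneg ((hB t).eigenvalues j - hA.eigenvalues i))
      have h6 := mul_le_mul_of_nonneg_left (h3.trans (add_le_add_right h5 η))
        (sq_nonneg (ovl hA (hB t) i j))
      linarith
    have hnn : 0 ≤ ((hfun m (hB t) - hfun m hA) * (hfun m (hB t) - hfun m hA)).trace := by
      rw [frob]; positivity
    rw [Real.dist_eq, sub_zero, abs_of_nonneg hnn]
    have g1 : d * η ≤ ε / 2 := by
      rw [hηd, mul_div_assoc', div_le_div_iff₀ (by positivity) (by positivity)]
      nlinarith
    have g2 : K * ((B t - A) * (B t - A)).trace < ε / 2 := by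
      have hn : 0 ≤ ((B t - A) * (B t - A)).trace := by rw [e2]; positivity
      rw [lt_div_iff₀ (by positivity)] at h1
      nlinarith
    linarith
  refine tendsto_pi_nhds.2 fun i => tendsto_pi_nhds.2 fun j => ?_
  rw [tendsto_iff_dist_tendsto_zero]
  have h0 := (Real.continuous_sqrt.tendsto 0).comp key
  rw [Real.sqrt_zero] at h0
  refine squeeze_zero (fun _ => dist_nonneg) (fun t => ?_) h0
  rw [Real.dist_eq]
  apply Real.abs_le_sqrt
  exact entry_le ((hfun_isHermitian m (hB t)).sub (hfun_isHermitian m hA)) i j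

/-- scalar Mazur map -/
noncomputable def smz (p : ℝ) (x : ℝ) : ℝ := Real.sign x * |x| ^ (p / 2)

theorem smz_eq (p : ℝ) (hp : 1 ≤ p) (x : ℝ) :
    (p / 2 + 1) * smz p x = (p / 2 + 1) * |x| ^ (p / 2 + 1 - 2) * x := by
  unfold smz
  rcases lt_trichotomy x 0 with h | h | h
  · rw [Real.sign_of_neg h, abs_of_neg h, show p / 2 = (p / 2 + 1 - 2) + 1 by ring,
      Real.rpow_add_one (by linarith)]
    ring_nf
  · simp [h]
  · rw [Real.sign_of_pos h, abs_of_pos h, show p / 2 = (p / 2 + 1 - 2) + 1 by ring,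
      Real.rpow_add_one (by linarith)]
    ring_nf

theorem smz_deriv (p : ℝ) (hp : 1 ≤ p) (x : ℝ) :
    HasDerivAt (fun x : ℝ => |x| ^ (p / 2 + 1)) ((p / 2 + 1) * smz p x) x := by
  rw [smz_eq p hp]
  exact hasDerivAt_abs_rpow x (by linarith)

theorem smz_cont (p : ℝ) (hp : 1 ≤ p) : Continuous (smz p) := by
  have h : smz p = fun x => (x⁺) ^ (p / 2) - (x⁻) ^ (p / 2) := by
    funext x
    unfold smz
    have hz : (0 : ℝ) ^ (p / 2) = 0 := Real.zero_rpow (by linarith)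
    rcases lt_trichotomy x 0 with h | h | h
    · rw [Real.sign_of_neg h, abs_of_neg h, posPart_eq_zero.2 h.le, negPart_eq_neg.2 h.le, hz]; ring
    · simp [h]
    · rw [Real.sign_of_pos h, abs_of_pos h, negPart_eq_zero.2 h.le, posPart_eq_self.2 h.le, hz]; ring
  rw [h]
  have h0 : 0 ≤ p / 2 := by linarith
  simp only [posPart_def, negPart_def]
  exact ((continuous_id.sup continuous_const).rpow_const fun _ => Or.inr h0).sub
    ((continuous_neg.sup continuous_const).rpow_const fun _ => Or.inr h0)

theorem abs_rpow_convex (q : ℝ) (hq : 1 ≤ q) : ConvexOn ℝ Set.univ (fun x : ℝ => |x| ^ q) := by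
  refine ⟨convex_univ, fun x _ y _ a b ha hb hab => ?_⟩
  have h1 : |a • x + b • y| ≤ a • |x| + b • |y| := by
    simp only [smul_eq_mul]
    calc _ ≤ |a * x| + |b * y| := abs_add_le _ _
      _ = _ := by rw [abs_mul, abs_mul, abs_of_nonneg ha, abs_of_nonneg hb]
  calc |a • x + b • y| ^ q ≤ (a • |x| + b • |y|) ^ q :=
        Real.rpow_le_rpow (abs_nonneg _) h1 (by linarith)
    _ ≤ _ := (convexOn_rpow hq).2 (abs_nonneg x) (abs_nonneg y) ha hb hab

theorem tangent (p : ℝ) (hp : 1 ≤ p) (a b : ℝ) :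
    |a| ^ (p / 2 + 1) + (p / 2 + 1) * smz p a * (b - a) ≤ |b| ^ (p / 2 + 1) := by
  have hc := abs_rpow_convex (p / 2 + 1) (by linarith)
  have hd := smz_deriv p hp a
  rcases lt_trichotomy a b with h | h | h
  · have := hc.le_slope_of_hasDerivAt (Set.mem_univ a) (Set.mem_univ b) h hd
    rw [slope_def_field, le_div_iff₀ (by linarith)] at this
    linarith
  · simp [h]
  · have := hc.slope_le_of_hasDerivAt (Set.mem_univ b) (Set.mem_univ a) h hd
    rw [slope_def_field, div_le_iff₀ (by linarith)] at this
    linarith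

theorem schatten_eq (p : ℝ) (hp : 1 ≤ p) {X : Matrix (Fin d) (Fin d) ℝ} (h : X.IsHermitian) :
    schattenNorm (p / 2 + 1) X ^ (p / 2 + 1) = (hfun (fun x => |x| ^ (p / 2 + 1)) h).trace := by
  rw [trace_hfun, schattenNorm, dif_pos h, ← Real.rpow_mul, one_div, inv_mul_cancel₀ (by linarith),
    Real.rpow_one]
  positivity

theorem mazur_eq (p : ℝ) {X : Matrix (Fin d) (Fin d) ℝ} (h : X.IsHermitian) :
    ncMazurMap p X = hfun (smz p) h := by
  rw [ncMazurMap, dif_pos h]; rfl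

theorem mazur_herm (p : ℝ) (X : Matrix (Fin d) (Fin d) ℝ) :
    (ncMazurMap p X).IsHermitian := by
  by_cases h : X.IsHermitian
  · rw [mazur_eq p h]; exact hfun_isHermitian _ h
  · rw [ncMazurMap, dif_neg h]; exact isHermitian_zero

theorem klein' (p : ℝ) (hp : 1 ≤ p) {A B : Matrix (Fin d) (Fin d) ℝ}
    (hA : A.IsHermitian) (hB : B.IsHermitian) :
    schattenNorm (p / 2 + 1) A ^ (p / 2 + 1) +
      (p / 2 + 1) * (ncMazurMap p A * (B - A)).trace ≤
    schattenNorm (p / 2 + 1) B ^ (p / 2 + 1) := by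
  have h := klein (fun x => |x| ^ (p / 2 + 1)) (fun x => (p / 2 + 1) * smz p x)
    (tangent p hp) hA hB
  have e : hfun (fun x => (p / 2 + 1) * smz p x) hA = (p / 2 + 1) • hfun (smz p) hA := by
    unfold hfun
    have : diagonal (fun i => (p / 2 + 1) * smz p (hA.eigenvalues i)) =
        (p / 2 + 1) • diagonal (fun i => smz p (hA.eigenvalues i)) := by
      rw [← diagonal_smul]; rfl
    rw [this, Matrix.mul_smul, Matrix.smul_mul]
  rw [e, Matrix.smul_mul, Matrix.trace_smul, smul_eq_mul] at h
  rw [schatten_eq p hp hA, schatten_eq p hp hB, mazur_eq p hA]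
  exact h

theorem schatten_convex (p : ℝ) (hp : 1 ≤ p) {A B : Matrix (Fin d) (Fin d) ℝ}
    (hA : A.IsHermitian) (hB : B.IsHermitian) {a b : ℝ} (ha : 0 ≤ a) (hb : 0 ≤ b)
    (hab : a + b = 1) :
    schattenNorm (p / 2 + 1) (a • A + b • B) ^ (p / 2 + 1) ≤
      a * schattenNorm (p / 2 + 1) A ^ (p / 2 + 1) +
      b * schattenNorm (p / 2 + 1) B ^ (p / 2 + 1) := by
  have hC : (a • A + b • B).IsHermitian :=
    (hA.smul (IsSelfAdjoint.all a)).add (hB.smul (IsSelfAdjoint.all b))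
  have h1 := mul_le_mul_of_nonneg_left (klein' p hp hC hA) ha
  have h2 := mul_le_mul_of_nonneg_left (klein' p hp hC hB) hb
  set C := a • A + b • B with hCd
  set M := ncMazurMap p C
  have h3 : a * (M * (A - C)).trace + b * (M * (B - C)).trace = 0 := by
    rw [← smul_eq_mul a, ← smul_eq_mul b, ← Matrix.trace_smul, ← Matrix.trace_smul,
      ← Matrix.mul_smul, ← Matrix.mul_smul, ← Matrix.trace_add, ← Matrix.mul_add]
    have : a • (A - C) + b • (B - C) = 0 := by
      have : a • (A - C) + b • (B - C) = C - (a + b) • C := by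
        rw [hCd]; module
      rw [this, hab, one_smul, sub_self]
    rw [this, Matrix.mul_zero, Matrix.trace_zero]
  set x := schattenNorm (p / 2 + 1) C ^ (p / 2 + 1)
  have h4 : x = a * x + b * x := by rw [← add_mul, hab, one_mul]
  linear_combination h1 + h2 + h4 - (p / 2 + 1) * h3

theorem stmt17 (p : ℝ) (hp : 1 ≤ p)
    (P : Finset (Matrix (Fin d) (Fin d) ℝ))
    (hP : ∀ X ∈ P, X.IsHermitian) :
    ConvexOn ℝ {S : Matrix (Fin d) (Fin d) ℝ | S.IsHermitian}
      (fun T => (P.card : ℝ)⁻¹ *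
        ∑ X ∈ P, schattenNorm (p / 2 + 1) (X - T) ^ (p / 2 + 1)) ∧
    ∀ T : Matrix (Fin d) (Fin d) ℝ, T.IsHermitian →
      (∀ S : Matrix (Fin d) (Fin d) ℝ, S.IsHermitian →
        (P.card : ℝ)⁻¹ * ∑ X ∈ P, schattenNorm (p / 2 + 1) (X - T) ^ (p / 2 + 1) ≤
          (P.card : ℝ)⁻¹ * ∑ X ∈ P, schattenNorm (p / 2 + 1) (X - S) ^ (p / 2 + 1)) →
      (P.card : ℝ)⁻¹ • ∑ X ∈ P, ncMazurMap p (X - T) = 0 := by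
  refine ⟨⟨?_, ?_⟩, ?_⟩
  · intro A hA B hB a b _ _ _
    exact (IsHermitian.smul hA (IsSelfAdjoint.all a)).add
      (IsHermitian.smul hB (IsSelfAdjoint.all b))
  · intro A hA B hB a b ha hb hab
    have hs : ∑ X ∈ P, schattenNorm (p / 2 + 1) (X - (a • A + b • B)) ^ (p / 2 + 1) ≤
        ∑ X ∈ P, (a * schattenNorm (p / 2 + 1) (X - A) ^ (p / 2 + 1) +
          b * schattenNorm (p / 2 + 1) (X - B) ^ (p / 2 + 1)) := by
      refine Finset.sum_le_sum fun X hX => ?_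
      have e : X - (a • A + b • B) = a • (X - A) + b • (X - B) := by
        have : a • (X - A) + b • (X - B) = (a + b) • X - (a • A + b • B) := by module
        rw [this, hab, one_smul]
      rw [e]
      exact schatten_convex p hp ((hP X hX).sub hA) ((hP X hX).sub hB) ha hb hab
    rw [Finset.sum_add_distrib, ← Finset.mul_sum, ← Finset.mul_sum] at hs
    have := mul_le_mul_of_nonneg_left hs (show 0 ≤ (P.card : ℝ)⁻¹ by positivity)
    simp only [smul_eq_mul]
    linarith
  · intro T hT hmin
    rcases P.eq_empty_or_nonempty with rfl | hne
    · simp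
    have hcard : 0 < (P.card : ℝ)⁻¹ := by
      have := hne.card_pos
      positivity
    set H := ∑ X ∈ P, ncMazurMap p (X - T) with hH
    have hHh : H.IsHermitian := by
      rw [hH, IsHermitian, conjTranspose_sum]
      exact Finset.sum_congr rfl fun X _ => mazur_herm p _
    have hS : ∀ t : ℝ, (T + t • H).IsHermitian := fun t =>
      hT.add (hHh.smul (IsSelfAdjoint.all t))
    have hneg : ∀ t : ℝ, 0 < t → ((∑ X ∈ P, ncMazurMap p (X - (T + t • H))) * H).trace ≤ 0 := by
      intro t ht
      have h1 := le_of_mul_le_mul_left (hmin _ (hS t)) hcard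
      have h2 := Finset.sum_le_sum fun X (hX : X ∈ P) =>
        klein' p hp ((hP X hX).sub (hS t)) ((hP X hX).sub hT)
      rw [Finset.sum_add_distrib] at h2
      have h3 : ∑ X ∈ P, (p / 2 + 1) *
          (ncMazurMap p (X - (T + t • H)) * (X - T - (X - (T + t • H)))).trace =
          ((p / 2 + 1) * t) * ((∑ X ∈ P, ncMazurMap p (X - (T + t • H))) * H).trace := by
        rw [Finset.sum_mul, Matrix.trace_sum, Finset.mul_sum]
        refine Finset.sum_congr rfl fun X _ => ?_
        have : X - T - (X - (T + t • H)) = t • H := by abel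
        rw [this, Matrix.mul_smul, Matrix.trace_smul, smul_eq_mul]
        ring
      rw [h3] at h2
      have hpos : 0 < (p / 2 + 1) * t := by positivity
      by_contra hcon
      push Not at hcon
      have := mul_pos hpos hcon
      linarith
    have hcurve : ∀ X : Matrix (Fin d) (Fin d) ℝ,
        Tendsto (fun t : ℝ => X - (T + t • H)) (𝓝[>] 0) (𝓝 (X - T)) := by
      intro X
      have hc : Continuous fun t : ℝ => X - (T + t • H) := by fun_prop
      have := hc.tendsto 0
      simp only [zero_smul, add_zero] at this
      exact this.mono_left nhdsWithin_le_nhds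
    have hlimM : Tendsto (fun t : ℝ => ∑ X ∈ P, ncMazurMap p (X - (T + t • H))) (𝓝[>] 0) (𝓝 H) := by
      rw [hH]
      refine tendsto_finsetSum _ fun X hX => ?_
      have hB : ∀ t : ℝ, (X - (T + t • H)).IsHermitian := fun t => (hP X hX).sub (hS t)
      have := hfun_tendsto (smz p) (smz_cont p hp) ((hP X hX).sub hT) _ hB (hcurve X)
      rw [← mazur_eq] at this
      refine this.congr fun t => ?_
      rw [mazur_eq p (hB t)]
    have hlim : Tendsto (fun t : ℝ => ((∑ X ∈ P, ncMazurMap p (X - (T + t • H))) * H).trace)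
        (𝓝[>] 0) (𝓝 (H * H).trace) := by
      have hc : Continuous fun Y : Matrix (Fin d) (Fin d) ℝ => (Y * H).trace := by fun_prop
      exact (hc.tendsto H).comp hlimM
    have hle : (H * H).trace ≤ 0 :=
      le_of_tendsto hlim (eventually_nhdsWithin_of_forall fun t ht => hneg t ht)
    have hzero : H = 0 := by
      ext i j
      have := (entry_le hHh i j).trans hle
      simpa using pow_eq_zero_iff two_ne_zero |>.1 (le_antisymm this (sq_nonneg _))
    rw [hzero, smul_zero]
end
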